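/- arXiv:2411.18955 — 5 statements merged into one kernel-verified Lean document; each statement's English description precedes it below -/
import Mathlib

section
/- Let G be a simple digraph, R a commutative unital ring, and w an allowed n-path in G (n ≥ 1), decomposed as w = Σ_{a,b} w^{[a,b]} where w^{[a,b]} collects the elementary allowed paths in w with tail a and head b. Then w lies in Ω_n(G) (i.e., ∂w is again an allowed path modulo degenerate paths) if and only if each w^{[a,b]} lies in Ω_n(G). -/
noncomputable section

namespace PrimitivePath

/-- A simple digraph: arrows between distinct vertices. -/
structure SDigraph (V : Type) where
  Adj : V → V → Prop
  loopless : ∀ v, ¬ Adj v v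

section

variable (R V : Type) [CommRing R] [DecidableEq V]

/-- `Chain R V n` is the free `R`-module `Λ_n(V,R)` on elementary `n`-paths
(sequences of `n+1` vertices). -/
abbrev Chain (n : ℕ) : Type _ := (Fin (n + 1) → V) →₀ R

/-- An elementary path is allowed if consecutive vertices are joined by arrows. -/
def IsAllowed {V : Type} (G : SDigraph V) {n : ℕ} (p : Fin (n + 1) → V) : Prop :=
  ∀ i : Fin n, G.Adj (p i.castSucc) (p i.succ)

/-- An elementary path is regular if it has no two equal consecutive vertices. -/
def IsRegular {V : Type} {n : ℕ} (p : Fin (n + 1) → V) : Prop :=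
  ∀ i : Fin n, p i.castSucc ≠ p i.succ

instance {n : ℕ} (p : Fin (n + 1) → V) : Decidable (IsRegular p) :=
  inferInstanceAs (Decidable (∀ i : Fin n, p i.castSucc ≠ p i.succ))

/-- The differential `∂ : Λ_{n+1} → Λ_n`, alternating sum of vertex deletions. -/
def boundary (n : ℕ) : Chain R V (n + 1) →ₗ[R] Chain R V n :=
  Finsupp.lsum R fun p => ∑ m : Fin (n + 2),
    ((-1 : R) ^ (m : ℕ)) • Finsupp.lsingle (fun i : Fin (n + 1) => p (m.succAbove i))

/-- The `m`-th face map `∂^m : Λ_{n+1} → Λ_n`, deleting the `m`-th vertex. -/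
def faceMap (n : ℕ) (m : Fin (n + 2)) : Chain R V (n + 1) →ₗ[R] Chain R V n :=
  Finsupp.lsum R fun p => Finsupp.lsingle (fun i : Fin (n + 1) => p (m.succAbove i))

/-- The submodule of chains all of whose elementary paths satisfy `P`. -/
def pathsWith {n : ℕ} (P : (Fin (n + 1) → V) → Prop) : Submodule R (Chain R V n) where
  carrier := {w | ∀ p ∈ w.support, P p}
  add_mem' := by
    intro x y hx hy p hp
    rcases Finset.mem_union.1 (Finsupp.support_add hp) with h | h
    · exact hx p h
    · exact hy p h
  zero_mem' := by intro p hp; simp at hp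
  smul_mem' := by intro c x hx p hp; exact hx p (Finsupp.support_smul hp)

/-- `A_n(G)`: the submodule of allowed chains. -/
def allowedChains (G : SDigraph V) (n : ℕ) : Submodule R (Chain R V n) :=
  pathsWith R V (fun p => IsAllowed G p)

/-- Chains all of whose elementary paths have tail vertex `a`. -/
def tailSet (a : V) (n : ℕ) : Submodule R (Chain R V n) :=
  pathsWith R V (fun p => p 0 = a)

/-- Chains all of whose elementary paths have head vertex `b`. -/
def headSet (b : V) (n : ℕ) : Submodule R (Chain R V n) :=
  pathsWith R V (fun p => p (Fin.last n) = b)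

/-- Chains all of whose elementary paths have tail `a` and head `b`
(the `(a,b)`-cluster module `Λ_n^{[a,b]}`). -/
def clusterSet (a b : V) (n : ℕ) : Submodule R (Chain R V n) :=
  pathsWith R V (fun p => p 0 = a ∧ p (Fin.last n) = b)

/-- Projection killing the irregular elementary paths, modelling `Λ_n → R_n = Λ_n/I_n`. -/
def regProj (n : ℕ) : Chain R V n →ₗ[R] Chain R V n :=
  Finsupp.lsum R fun p => if IsRegular p then Finsupp.lsingle p else 0

/-- The `(a,b)`-cluster component `w ↦ w^{[a,b]}`. -/
def clusterComp (a b : V) (n : ℕ) : Chain R V n →ₗ[R] Chain R V n :=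
  Finsupp.lsum R fun p =>
    if p 0 = a ∧ p (Fin.last n) = b then Finsupp.lsingle p else 0

/-- The `a`-tail component `w ↦ w^{[a,·]}`. -/
def tailComp (a : V) (n : ℕ) : Chain R V n →ₗ[R] Chain R V n :=
  Finsupp.lsum R fun p => if p 0 = a then Finsupp.lsingle p else 0

/-- The `b`-head component `w ↦ w^{[·,b]}`. -/
def headComp (b : V) (n : ℕ) : Chain R V n →ₗ[R] Chain R V n :=
  Finsupp.lsum R fun p => if p (Fin.last n) = b then Finsupp.lsingle p else 0

/-- `Π_n(G)`: the primitive path chain modules. -/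
def piChains (G : SDigraph V) : (n : ℕ) → Submodule R (Chain R V n)
  | 0 => allowedChains R V G 0
  | n + 1 =>
      allowedChains R V G (n + 1) ⊓ (allowedChains R V G n).comap (boundary R V n)

/-- `Ω_n(G)`: the path chain modules (differential taken modulo irregular paths). -/
def omegaChains (G : SDigraph V) : (n : ℕ) → Submodule R (Chain R V n)
  | 0 => allowedChains R V G 0
  | n + 1 =>
      allowedChains R V G (n + 1) ⊓
        (allowedChains R V G n).comap ((regProj R V n).comp (boundary R V n))

/-- Cycles of the primitive path chain complex. -/
def piCycles (G : SDigraph V) : (n : ℕ) → Submodule R (Chain R V n)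
  | 0 => piChains R V G 0
  | n + 1 => piChains R V G (n + 1) ⊓ LinearMap.ker (boundary R V n)

/-- Boundaries of the primitive path chain complex. -/
def piBoundaries (G : SDigraph V) (n : ℕ) : Submodule R (Chain R V n) :=
  (piChains R V G (n + 1)).map (boundary R V n)

/-- Primitive path homology `H_n(Π_*(G))`: the image of the cycles in the
quotient by the boundaries. -/
abbrev piHomology (G : SDigraph V) (n : ℕ) : Type _ :=
  ↥((piCycles R V G n).map (piBoundaries R V G n).mkQ)

/-- Cycles of the path chain complex `Ω_*`. -/
def omegaCycles (G : SDigraph V) : (n : ℕ) → Submodule R (Chain R V n)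
  | 0 => omegaChains R V G 0
  | n + 1 => omegaChains R V G (n + 1) ⊓ LinearMap.ker ((regProj R V n).comp (boundary R V n))

/-- Boundaries of the path chain complex `Ω_*`. -/
def omegaBoundaries (G : SDigraph V) (n : ℕ) : Submodule R (Chain R V n) :=
  (omegaChains R V G (n + 1)).map ((regProj R V n).comp (boundary R V n))

/-- Path homology `H_n(Ω_*(G))`. -/
abbrev omegaHomology (G : SDigraph V) (n : ℕ) : Type _ :=
  ↥((omegaCycles R V G n).map (omegaBoundaries R V G n).mkQ)

/-- The cluster differential `d : Λ_{n+2}^{[a,b]} → Λ_{n+1}^{[a,b]}`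
(alternating deletion of interior vertices only). -/
def clusterBoundary (n : ℕ) : Chain R V (n + 2) →ₗ[R] Chain R V (n + 1) :=
  Finsupp.lsum R fun p => ∑ m : Fin (n + 1),
    ((-1 : R) ^ (m : ℕ)) •
      Finsupp.lsingle (fun i : Fin (n + 2) => p (m.succ.castSucc.succAbove i))

/-- `π^{[a,b]}` in degrees `≥ 2`: delete the two end vertices. -/
def stripEnds (n : ℕ) : Chain R V (n + 2) →ₗ[R] Chain R V n :=
  Finsupp.lsum R fun p => Finsupp.lsingle (fun i : Fin (n + 1) => p i.succ.castSucc)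

/-- The sum-of-coefficients map (augmentation when `n = 0`). -/
def totalCoeff (n : ℕ) : Chain R V n →ₗ[R] R :=
  Finsupp.lsum R fun _ => LinearMap.id

/-- `A_n^{[a,b]}(G)`: allowed `(a,b)`-cluster chains. -/
def allowedCluster (G : SDigraph V) (a b : V) (n : ℕ) : Submodule R (Chain R V n) :=
  allowedChains R V G n ⊓ clusterSet R V a b n

/-- `Θ_n^{[a,b]}(G)`. -/
def thetaChains (G : SDigraph V) (a b : V) : (n : ℕ) → Submodule R (Chain R V n)
  | 0 => ⊥
  | 1 => allowedCluster R V G a b 1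
  | n + 2 =>
      allowedCluster R V G a b (n + 2) ⊓
        (allowedCluster R V G a b (n + 1)).comap (clusterBoundary R V n)

def thetaCycles (G : SDigraph V) (a b : V) : (n : ℕ) → Submodule R (Chain R V n)
  | 0 => ⊥
  | 1 => thetaChains R V G a b 1
  | n + 2 => thetaChains R V G a b (n + 2) ⊓ LinearMap.ker (clusterBoundary R V n)

def thetaBoundaries (G : SDigraph V) (a b : V) : (n : ℕ) → Submodule R (Chain R V n)
  | 0 => ⊥
  | n + 1 => (thetaChains R V G a b (n + 2)).map (clusterBoundary R V n)

/-- Primitive `(a,b)`-cluster homology `H_n^{[a,b]}(G)`. -/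
abbrev thetaHomology (G : SDigraph V) (a b : V) (n : ℕ) : Type _ :=
  ↥((thetaCycles R V G a b n).map (thetaBoundaries R V G a b n).mkQ)

/-- The tail differential `d^t` (never deleting the tail vertex). -/
def tailBoundary (n : ℕ) : Chain R V (n + 1) →ₗ[R] Chain R V n :=
  Finsupp.lsum R fun p => ∑ m : Fin (n + 1),
    ((-1 : R) ^ (m : ℕ)) • Finsupp.lsingle (fun i : Fin (n + 1) => p (m.succ.succAbove i))

/-- The head differential `d^h` (never deleting the head vertex). -/
def headBoundary (n : ℕ) : Chain R V (n + 1) →ₗ[R] Chain R V n :=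
  Finsupp.lsum R fun p => ∑ m : Fin (n + 1),
    ((-1 : R) ^ (m : ℕ)) • Finsupp.lsingle (fun i : Fin (n + 1) => p (m.castSucc.succAbove i))

/-- `π^{[a,·]}` in degrees `≥ 1`: delete the first vertex. -/
def stripHead (n : ℕ) : Chain R V (n + 1) →ₗ[R] Chain R V n :=
  Finsupp.lsum R fun p => Finsupp.lsingle (fun i : Fin (n + 1) => p i.succ)

/-- `π^{[·,a]}` in degrees `≥ 1`: delete the last vertex. -/
def stripLast (n : ℕ) : Chain R V (n + 1) →ₗ[R] Chain R V n :=
  Finsupp.lsum R fun p => Finsupp.lsingle (fun i : Fin (n + 1) => p i.castSucc)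

/-- `A_n^{[a,·]}(G)`: allowed chains with tail `a`. -/
def allowedTail (G : SDigraph V) (a : V) (n : ℕ) : Submodule R (Chain R V n) :=
  allowedChains R V G n ⊓ tailSet R V a n

/-- `A_n^{[·,a]}(G)`: allowed chains with head `a`. -/
def allowedHead (G : SDigraph V) (a : V) (n : ℕ) : Submodule R (Chain R V n) :=
  allowedChains R V G n ⊓ headSet R V a n

/-- `Θ_n^{[a,·]}(G)`. -/
def tailTheta (G : SDigraph V) (a : V) : (n : ℕ) → Submodule R (Chain R V n)
  | 0 => allowedTail R V G a 0
  | n + 1 =>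
      allowedTail R V G a (n + 1) ⊓ (allowedTail R V G a n).comap (tailBoundary R V n)

/-- `Θ_n^{[·,a]}(G)`. -/
def headTheta (G : SDigraph V) (a : V) : (n : ℕ) → Submodule R (Chain R V n)
  | 0 => allowedHead R V G a 0
  | n + 1 =>
      allowedHead R V G a (n + 1) ⊓ (allowedHead R V G a n).comap (headBoundary R V n)

def tailCycles (G : SDigraph V) (a : V) : (n : ℕ) → Submodule R (Chain R V n)
  | 0 => tailTheta R V G a 0
  | n + 1 => tailTheta R V G a (n + 1) ⊓ LinearMap.ker (tailBoundary R V n)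

def tailBoundaries (G : SDigraph V) (a : V) (n : ℕ) : Submodule R (Chain R V n) :=
  (tailTheta R V G a (n + 1)).map (tailBoundary R V n)

/-- Primitive `a`-tail homology `H_n^{[a,·]}(G)`. -/
abbrev tailHomology (G : SDigraph V) (a : V) (n : ℕ) : Type _ :=
  ↥((tailCycles R V G a n).map (tailBoundaries R V G a n).mkQ)

/-- The path-reversal map with sign `(-1)^{n(n+1)/2}`. -/
def revMap (n : ℕ) : Chain R V n →ₗ[R] Chain R V n :=
  Finsupp.lsum R fun p =>
    ((-1 : R) ^ (n * (n + 1) / 2)) • Finsupp.lsingle (fun i : Fin (n + 1) => p i.rev)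

end

/-- The inverse directed digraph: all arrows reversed. -/
def SDigraph.reverse {V : Type} (G : SDigraph V) : SDigraph V where
  Adj v w := G.Adj w v
  loopless v h := G.loopless v h

section

variable (R : Type) [CommRing R] (V W : Type) [DecidableEq V] [DecidableEq W]

/-- The chain map `f_♯` induced by a vertex map: elementary paths go to their image
when regular, and to `0` otherwise. -/
def chainMap (f : V → W) (n : ℕ) : Chain R V n →ₗ[R] Chain R W n :=
  Finsupp.lsum R fun p =>
    if IsRegular (fun i => f (p i)) then Finsupp.lsingle (fun i => f (p i)) else 0

end

/-- A digraph is asymmetric if it has no symmetric pair of arrows. -/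
def SDigraph.Asymmetric {V : Type} (G : SDigraph V) : Prop :=
  ∀ v w, G.Adj v w → ¬ G.Adj w v


theorem clusterComp_apply' (R V : Type) [CommRing R] [DecidableEq V] (a b : V) (n : ℕ)
    (w : Chain R V n) (q : Fin (n + 1) → V) :
    clusterComp R V a b n w q = if q 0 = a ∧ q (Fin.last n) = b then w q else 0 := by
  induction w using Finsupp.induction_linear with
  | zero => simp
  | add f g hf hg => rw [map_add, Finsupp.add_apply, hf, hg]; split_ifs <;> simp
  | single p r =>
    simp only [clusterComp, Finsupp.lsum_single]
    by_cases hpq : p = q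
    · subst hpq; split_ifs <;> simp
    · split_ifs <;> simp [Finsupp.single_eq_of_ne' hpq]

theorem regProj_apply' (R V : Type) [CommRing R] [DecidableEq V] (n : ℕ)
    (w : Chain R V n) (q : Fin (n + 1) → V) :
    regProj R V n w q = if IsRegular q then w q else 0 := by
  induction w using Finsupp.induction_linear with
  | zero => simp
  | add f g hf hg => rw [map_add, Finsupp.add_apply, hf, hg]; split_ifs <;> simp
  | single p r =>
    simp only [regProj, Finsupp.lsum_single]
    by_cases hpq : p = q
    · subst hpq; split_ifs <;> simp
    · split_ifs <;> simp [Finsupp.single_eq_of_ne' hpq]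

theorem mem_allowed_iff (R V : Type) [CommRing R] [DecidableEq V] (G : SDigraph V) (n : ℕ)
    (w : Chain R V n) :
    w ∈ allowedChains R V G n ↔ ∀ q, w q ≠ 0 → IsAllowed G q := by
  change (∀ p ∈ w.support, IsAllowed G p) ↔ _
  simp only [Finsupp.mem_support_iff]

/-- Interior part of the boundary: only interior vertices are deleted. -/
def interiorPart (R V : Type) [CommRing R] [DecidableEq V] (n : ℕ) : Chain R V (n + 1) →ₗ[R] Chain R V n :=
  ∑ m : Fin (n + 2), if m = 0 ∨ m = Fin.last (n + 1) then 0 else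
    ((-1 : R) ^ (m : ℕ)) • faceMap R V n m

/-- End part of the boundary: only end vertices are deleted. -/
def endPart (R V : Type) [CommRing R] [DecidableEq V] (n : ℕ) : Chain R V (n + 1) →ₗ[R] Chain R V n :=
  ∑ m : Fin (n + 2), if m = 0 ∨ m = Fin.last (n + 1) then
    ((-1 : R) ^ (m : ℕ)) • faceMap R V n m else 0

theorem boundary_eq_parts (R V : Type) [CommRing R] [DecidableEq V] (n : ℕ) :
    boundary R V n = interiorPart R V n + endPart R V n := by
  rw [interiorPart, endPart, ← Finset.sum_add_distrib]
  refine Finsupp.lhom_ext fun p r => ?_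
  simp only [boundary, Finsupp.lsum_single, LinearMap.sum_apply]
  refine Finset.sum_congr rfl fun m _ => ?_
  split_ifs <;> simp [faceMap]

theorem endPart_allowed (R V : Type) [CommRing R] [DecidableEq V] (G : SDigraph V) (n : ℕ)
    (w : Chain R V (n + 1)) (hw : w ∈ allowedChains R V G (n + 1)) :
    endPart R V n w ∈ allowedChains R V G n := by
  rw [endPart, LinearMap.sum_apply]
  refine Submodule.sum_mem _ fun m _ => ?_
  split_ifs with hm
  · rw [LinearMap.smul_apply]
    refine Submodule.smul_mem _ _ ?_
    rw [faceMap, Finsupp.lsum_apply, Finsupp.sum]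
    refine Submodule.sum_mem _ fun p hp => ?_
    have hpa : IsAllowed G p := hw p hp
    rw [mem_allowed_iff]
    intro q hq
    have : (fun i : Fin (n + 1) => p (m.succAbove i)) = q := by
      by_contra h
      exact hq (Finsupp.single_eq_of_ne' h)
    subst this
    intro i
    rcases hm with rfl | rfl
    · have := hpa i.succ
      simpa [Fin.succAbove_zero] using this
    · have := hpa i.castSucc
      simpa [Fin.succAbove_last] using this
  · simp

theorem interiorPart_clusterComp (R V : Type) [CommRing R] [DecidableEq V] (a b : V) (n : ℕ)
    (w : Chain R V (n + 1)) :
    interiorPart R V n (clusterComp R V a b (n + 1) w) =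
      clusterComp R V a b n (interiorPart R V n w) := by
  simp only [interiorPart, LinearMap.sum_apply, map_sum]
  refine Finset.sum_congr rfl fun m _ => ?_
  split_ifs with hm
  · simp
  · push Not at hm
    simp only [LinearMap.smul_apply, map_smul]
    congr 1
    induction w using Finsupp.induction_linear with
    | zero => simp
    | add f g hf hg => simp only [map_add, hf, hg]
    | single p r =>
      simp only [clusterComp, faceMap, Finsupp.lsum_single, Finsupp.lsingle_apply]
      simp only [Fin.succAbove_ne_zero_zero hm.1, Fin.succAbove_ne_last_last hm.2]
      split_ifs <;> simp

theorem mem_omega_iff (R V : Type) [CommRing R] [DecidableEq V] (G : SDigraph V) (n : ℕ)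
    (w : Chain R V (n + 1)) (hw : w ∈ allowedChains R V G (n + 1)) :
    w ∈ omegaChains R V G (n + 1) ↔
      ∀ q, IsRegular q → interiorPart R V n w q ≠ 0 → IsAllowed G q := by
  have he := endPart_allowed R V G n w hw
  have he' : regProj R V n (endPart R V n w) ∈ allowedChains R V G n := by
    rw [mem_allowed_iff] at he ⊢
    intro q hq
    rw [regProj_apply'] at hq
    exact he q (by split_ifs at hq <;> simp_all)
  have h1 : w ∈ omegaChains R V G (n + 1) ↔
      regProj R V n (interiorPart R V n w) ∈ allowedChains R V G n := by
    change (w ∈ allowedChains R V G (n + 1) ∧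
      regProj R V n (boundary R V n w) ∈ allowedChains R V G n) ↔ _
    rw [boundary_eq_parts, LinearMap.add_apply, map_add, Submodule.add_mem_iff_left _ he']
    exact and_iff_right hw
  rw [h1, mem_allowed_iff]
  simp only [regProj_apply']
  refine forall_congr' fun q => ?_
  split_ifs with h <;> simp [h]

/-- Theorem 2.3: an allowed path `w` lies in `Ω_n(G)` iff each of its
`(a,b)`-cluster components `w^{[a,b]}` lies in `Ω_n(G)`. -/
theorem omega_cluster_decomposition
    (R : Type) [CommRing R] (V : Type) [DecidableEq V] [Fintype V]
    (G : SDigraph V) (n : ℕ) (w : Chain R V (n + 1))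
    (hw : w ∈ allowedChains R V G (n + 1)) :
    w ∈ omegaChains R V G (n + 1) ↔
      ∀ a b : V, clusterComp R V a b (n + 1) w ∈ omegaChains R V G (n + 1) := by
  have hc : ∀ a b, clusterComp R V a b (n + 1) w ∈ allowedChains R V G (n + 1) := by
    intro a b
    rw [mem_allowed_iff] at hw ⊢
    intro q hq
    rw [clusterComp_apply'] at hq
    exact hw q (by split_ifs at hq <;> simp_all)
  rw [mem_omega_iff R V G n w hw]
  simp only [fun a b => mem_omega_iff R V G n _ (hc a b), interiorPart_clusterComp,
    clusterComp_apply']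
  constructor
  · intro h a b q hq hne
    refine h q hq ?_
    intro h0
    simp [h0] at hne
  · intro h q hq hne
    exact h (q 0) (q (Fin.last n)) q hq (by simpa using hne)

end PrimitivePath

end
end

section
/- Let G be the complete digraph on two vertices 0, 1 with both arrows 0→1 and 1→0, and take integer coefficients. Then the primitive path chain complex satisfies Π_n(G) = 0 for n ≥ 2, and the primitive path homology is H_0 ≅ Z, H_1 ≅ Z, and H_n = 0 for n ≥ 2. In particular primitive path homology differs from path homology, for which H_1(G) = 0. -/
noncomputable section

namespace PrimitivePath

/-- The complete digraph on two vertices `0, 1` with both arrows `0 → 1` and `1 → 0`. -/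
def K2 : SDigraph (Fin 2) := ⟨fun i j => i ≠ j, fun _ h => h rfl⟩

theorem hom_equiv {M : Type*} [AddCommGroup M] (Z B : Submodule ℤ M) (f : M →ₗ[ℤ] ℤ)
    (hB : ∀ x ∈ B, f x = 0) (hZ : ∀ x ∈ Z, f x = 0 → x ∈ B) (z : M) (hz : z ∈ Z)
    (hfz : f z = 1) : Nonempty (↥(Z.map B.mkQ) ≃ₗ[ℤ] ℤ) := by
  have hB' : B ≤ LinearMap.ker f := fun x hx => hB x hx
  refine ⟨LinearEquiv.ofBijective ((B.liftQ f hB').comp (Z.map B.mkQ).subtype) ⟨?_, ?_⟩⟩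
  · rw [← LinearMap.ker_eq_bot, LinearMap.ker_eq_bot']
    rintro ⟨_, x, hx, rfl⟩ h
    have h' : f x = 0 := by simpa using h
    ext
    simpa using hZ x hx h'
  · intro c
    refine ⟨⟨B.mkQ (c • z), ⟨c • z, Z.smul_mem c hz, rfl⟩⟩, ?_⟩
    simp [hfz]

theorem hom_subsingleton {M : Type*} [AddCommGroup M] (Z B : Submodule ℤ M) (h : Z ≤ B) :
    Subsingleton ↥(Z.map B.mkQ) := by
  refine ⟨?_⟩
  rintro ⟨_, x, hx, rfl⟩ ⟨_, y, hy, rfl⟩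
  ext
  have : x - y ∈ B := B.sub_mem (h hx) (h hy)
  simpa [Submodule.Quotient.eq] using this

theorem boundary_single' (n : ℕ) (p : Fin (n + 2) → Fin 2) (c : ℤ) :
    boundary ℤ (Fin 2) n (Finsupp.single p c) = ∑ m : Fin (n + 2),
      Finsupp.single (fun i : Fin (n + 1) => p (m.succAbove i)) ((-1 : ℤ) ^ (m : ℕ) * c) := by
  simp [boundary, LinearMap.sum_apply]

theorem boundary_coeff (n : ℕ) (w : Chain ℤ (Fin 2) (n + 1)) (q : Fin (n + 1) → Fin 2) :
    boundary ℤ (Fin 2) n w q = ∑ p ∈ w.support, ∑ m : Fin (n + 2),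
      if (fun i : Fin (n + 1) => p (m.succAbove i)) = q then ((-1 : ℤ) ^ (m : ℕ) * w p) else 0 := by
  conv_lhs => rw [← Finsupp.sum_single w, Finsupp.sum, map_sum]
  rw [Finsupp.finsetSum_apply]
  refine Finset.sum_congr rfl fun p _ => ?_
  rw [boundary_single', Finsupp.finsetSum_apply]
  refine Finset.sum_congr rfl fun m _ => ?_
  rw [Finsupp.single_apply]

theorem allowed_ext {n : ℕ} {p q : Fin (n + 1) → Fin 2} (hp : IsAllowed K2 p)
    (hq : IsAllowed K2 q) (h : p 0 = q 0) : p = q := by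
  funext i
  induction i using Fin.induction with
  | zero => exact h
  | succ i ih =>
    have h1 : p i.castSucc ≠ p i.succ := hp i
    have h2 : q i.castSucc ≠ q i.succ := hq i
    omega

theorem face_eq {k : ℕ} {p p0 : Fin (k + 3) → Fin 2} (hp : IsAllowed K2 p)
    (hp0 : IsAllowed K2 p0) (m : Fin (k + 3))
    (h : (fun i : Fin (k + 2) => p (m.succAbove i)) =
      fun i : Fin (k + 2) => p0 ((1 : Fin (k + 3)).succAbove i)) : m = 1 ∧ p = p0 := by
  have e0 := congrFun h 0
  have e1 := congrFun h 1
  have a0 : p 0 ≠ p 1 := hp 0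
  have a1 : p 1 ≠ p 2 := hp 1
  have b0 : p0 0 ≠ p0 1 := hp0 0
  have b1 : p0 1 ≠ p0 2 := hp0 1
  have s0 : (1 : Fin (k + 3)).succAbove 0 = 0 := by
    simp [Fin.succAbove, Fin.lt_def]
  have s1 : (1 : Fin (k + 3)).succAbove 1 = 2 := by
    simp [Fin.succAbove, Fin.lt_def, Fin.ext_iff]
  simp only [s0, s1] at e0 e1
  by_cases hm : m = 1
  · subst hm
    simp only [s0, s1] at e0 e1
    exact ⟨rfl, allowed_ext hp hp0 e0⟩
  · exfalso
    by_cases hm0 : m = 0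
    · subst hm0
      have t0 : (0 : Fin (k + 3)).succAbove 0 = 1 := by simp
      have t1 : (0 : Fin (k + 3)).succAbove 1 = 2 := by simp [Fin.ext_iff]
      simp only [t0, t1] at e0 e1
      omega
    · have hm2 : 2 ≤ m.val := by
        have h0 : m.val ≠ 0 := fun h => hm0 (Fin.ext h)
        have h1 : m.val ≠ 1 := fun h => hm (Fin.ext (by simpa using h))
        omega
      have t0 : m.succAbove 0 = 0 := by
        rw [Fin.succAbove_of_castSucc_lt]
        · simp
        · rw [Fin.lt_def]
          simp only [Fin.val_castSucc, Fin.val_zero, Fin.val_one]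
          omega
      have t1 : m.succAbove 1 = 1 := by
        rw [Fin.succAbove_of_castSucc_lt]
        · simp
        · rw [Fin.lt_def]
          simp only [Fin.val_castSucc, Fin.val_zero, Fin.val_one]
          omega
      simp only [t0, t1] at e0 e1
      omega

theorem pi_bot (k : ℕ) : piChains ℤ (Fin 2) K2 (k + 2) = ⊥ := by
  rw [eq_bot_iff]
  rintro w ⟨hw, hb⟩
  have hw' : ∀ p ∈ w.support, IsAllowed K2 p := hw
  have hb' : ∀ q ∈ (boundary ℤ (Fin 2) (k + 1) w).support, IsAllowed K2 q := hb
  rw [Submodule.mem_bot, ← Finsupp.support_eq_empty, Finset.eq_empty_iff_forall_notMem]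
  intro p0 hp0
  have ha := hw' p0 hp0
  set q : Fin (k + 2) → Fin 2 := fun i => p0 ((1 : Fin (k + 3)).succAbove i) with hq
  have hc : boundary ℤ (Fin 2) (k + 1) w q = - w p0 := by
    rw [boundary_coeff, Finset.sum_eq_single p0, Finset.sum_eq_single 1]
    · simp [hq]
    · intro m _ hm
      rw [if_neg]
      exact fun h => hm (face_eq ha ha m h).1
    · simp
    · intro p hp hne
      refine Finset.sum_eq_zero fun m _ => ?_
      rw [if_neg]
      exact fun h => hne (face_eq (hw' p hp) ha m h).2
    · exact fun h => absurd hp0 h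
  have hqs : q ∈ (boundary ℤ (Fin 2) (k + 1) w).support := by
    rw [Finsupp.mem_support_iff, hc]
    simpa using hp0
  have h0 : q 0 ≠ q 1 := hb' q hqs 0
  have s0 : (1 : Fin (k + 3)).succAbove 0 = 0 := by
    simp [Fin.succAbove, Fin.lt_def]
  have s1 : (1 : Fin (k + 3)).succAbove 1 = 2 := by
    simp [Fin.succAbove, Fin.lt_def, Fin.ext_iff]
  simp only [hq, s0, s1] at h0
  have b0 : p0 0 ≠ p0 1 := ha 0
  have b1 : p0 1 ≠ p0 2 := ha 1
  omega

theorem allowed_zero (w : Chain ℤ (Fin 2) 0) : w ∈ allowedChains ℤ (Fin 2) K2 0 :=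
  fun _ _ i => i.elim0

theorem chain_zero (w : Chain ℤ (Fin 2) 0) :
    w = Finsupp.single ![0] (w ![0]) + Finsupp.single ![1] (w ![1]) := by
  ext p
  have hp : p = ![0] ∨ p = ![1] := by revert p; decide
  rcases hp with rfl | rfl <;> simp [Finsupp.single_apply]

theorem chain_one (w : Chain ℤ (Fin 2) 1) (hw : w ∈ allowedChains ℤ (Fin 2) K2 1) :
    w = Finsupp.single ![0, 1] (w ![0, 1]) + Finsupp.single ![1, 0] (w ![1, 0]) := by
  ext p
  by_cases hp : p ∈ w.support
  · have ha : p 0 ≠ p 1 := hw p hp 0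
    have hp : p = ![0, 1] ∨ p = ![1, 0] := by clear hp; revert p; decide
    rcases hp with rfl | rfl <;> simp [Finsupp.single_apply]
  · have h0 : w p = 0 := by simpa using hp
    by_cases h1 : p = ![0, 1]
    · subst h1; simp [Finsupp.single_apply]
    · by_cases h2 : p = ![1, 0]
      · subst h2; simp [Finsupp.single_apply]
      · simp [Finsupp.single_apply, h0, Ne.symm h1, Ne.symm h2]

theorem allowed_single {n : ℕ} (p : Fin (n + 1) → Fin 2) (c : ℤ) (hp : IsAllowed K2 p) :
    Finsupp.single p c ∈ allowedChains ℤ (Fin 2) K2 n := by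
  intro q hq
  have := Finsupp.support_single_subset hq
  rw [Finset.mem_singleton] at this
  exact this ▸ hp

theorem al01 : IsAllowed K2 ![0, 1] := by
  intro i; fin_cases i; simp [K2]

theorem al10 : IsAllowed K2 ![1, 0] := by
  intro i; fin_cases i; simp [K2]

theorem al010 : IsAllowed K2 ![0, 1, 0] := by
  intro i; fin_cases i <;> simp [K2]

theorem bd01 (c : ℤ) : boundary ℤ (Fin 2) 0 (Finsupp.single ![0, 1] c) =
    Finsupp.single ![1] c - Finsupp.single ![0] c := by
  have h0 : (fun i : Fin 1 => (![0, 1] : Fin 2 → Fin 2) ((0 : Fin 2).succAbove i)) = ![1] := by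
    decide
  have h1 : (fun i : Fin 1 => (![0, 1] : Fin 2 → Fin 2) ((1 : Fin 2).succAbove i)) = ![0] := by
    decide
  rw [boundary_single', Fin.sum_univ_two, h0, h1]
  simp [sub_eq_add_neg]

theorem bd10 (c : ℤ) : boundary ℤ (Fin 2) 0 (Finsupp.single ![1, 0] c) =
    Finsupp.single ![0] c - Finsupp.single ![1] c := by
  have h0 : (fun i : Fin 1 => (![1, 0] : Fin 2 → Fin 2) ((0 : Fin 2).succAbove i)) = ![0] := by
    decide
  have h1 : (fun i : Fin 1 => (![1, 0] : Fin 2 → Fin 2) ((1 : Fin 2).succAbove i)) = ![1] := by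
    decide
  rw [boundary_single', Fin.sum_univ_two, h0, h1]
  simp [sub_eq_add_neg]

theorem regProj_single' {n : ℕ} (p : Fin (n + 1) → Fin 2) (c : ℤ) :
    regProj ℤ (Fin 2) n (Finsupp.single p c) = if IsRegular p then Finsupp.single p c else 0 := by
  simp only [regProj, Finsupp.lsum_single]
  split_ifs <;> simp

theorem regProj_zero (w : Chain ℤ (Fin 2) 0) : regProj ℤ (Fin 2) 0 w = w := by
  rw [chain_zero w, map_add, regProj_single', regProj_single', if_pos, if_pos] <;>
    exact fun i => i.elim0

theorem regbd010 (c : ℤ) :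
    regProj ℤ (Fin 2) 1 (boundary ℤ (Fin 2) 1 (Finsupp.single ![0, 1, 0] c)) =
    Finsupp.single ![0, 1] c + Finsupp.single ![1, 0] c := by
  have h0 : (fun i : Fin 2 => (![0, 1, 0] : Fin 3 → Fin 2) ((0 : Fin 3).succAbove i)) = ![1, 0] := by
    decide
  have h1 : (fun i : Fin 2 => (![0, 1, 0] : Fin 3 → Fin 2) ((1 : Fin 3).succAbove i)) = ![0, 0] := by
    decide
  have h2 : (fun i : Fin 2 => (![0, 1, 0] : Fin 3 → Fin 2) ((2 : Fin 3).succAbove i)) = ![0, 1] := by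
    decide
  have r0 : IsRegular (![1, 0] : Fin 2 → Fin 2) := by decide
  have r1 : ¬ IsRegular (![0, 0] : Fin 2 → Fin 2) := by decide
  have r2 : IsRegular (![0, 1] : Fin 2 → Fin 2) := by decide
  rw [boundary_single', Fin.sum_univ_three, h0, h1, h2]
  rw [map_add, map_add, regProj_single', regProj_single', regProj_single', if_pos r0, if_neg r1,
    if_pos r2]
  simp [add_comm]

theorem cycle_one (w : Chain ℤ (Fin 2) 1) (hw : w ∈ allowedChains ℤ (Fin 2) K2 1)
    (h : boundary ℤ (Fin 2) 0 w = 0) :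
    w = Finsupp.single ![0, 1] (w ![0, 1]) + Finsupp.single ![1, 0] (w ![0, 1]) := by
  have e := chain_one w hw
  have h' := h
  rw [e, map_add, bd01, bd10] at h'
  have h2 := DFunLike.congr_fun h' ![0]
  simp [Finsupp.single_apply] at h2
  have h3 : w ![1, 0] = w ![0, 1] := by linarith
  rw [h3] at e
  exact e

theorem boundaries_bot (k : ℕ) : piBoundaries ℤ (Fin 2) K2 (k + 1) = ⊥ := by
  rw [piBoundaries, pi_bot, Submodule.map_bot]

theorem H0 : Nonempty (piHomology ℤ (Fin 2) K2 0 ≃ₗ[ℤ] ℤ) := by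
  have t : ∀ (p : Fin 1 → Fin 2) (c : ℤ), totalCoeff ℤ (Fin 2) 0 (Finsupp.single p c) = c := by
    intro p c; simp [totalCoeff]
  refine hom_equiv _ _ (totalCoeff ℤ (Fin 2) 0) ?_ ?_ (Finsupp.single ![0] 1)
    (allowed_zero _) (t _ _)
  · rintro _ ⟨w, hw, rfl⟩
    rw [chain_one w hw.1, map_add, bd01, bd10]
    simp only [map_add, map_sub, t]
    ring
  · intro w _ h
    have e := chain_zero w
    have h' := h
    rw [e, map_add, t, t] at h'
    refine ⟨Finsupp.single ![0, 1] (w ![1]),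
      ⟨allowed_single _ _ al01, allowed_zero _⟩, ?_⟩
    rw [bd01]
    conv_rhs => rw [e]
    have : w ![0] = - w ![1] := by linarith
    rw [this, Finsupp.single_neg]
    abel

theorem H1 : Nonempty (piHomology ℤ (Fin 2) K2 1 ≃ₗ[ℤ] ℤ) := by
  refine hom_equiv _ _ (Finsupp.lapply ![0, 1]) ?_ ?_
    (Finsupp.single ![0, 1] 1 + Finsupp.single ![1, 0] 1) ?_ ?_
  · intro x hx
    rw [boundaries_bot, Submodule.mem_bot] at hx
    simp [hx]
  · rintro w ⟨hw, hk⟩ h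
    have h' : w ![0, 1] = 0 := h
    rw [cycle_one w hw.1 hk, h']
    simp
  · refine ⟨⟨Submodule.add_mem _ (allowed_single _ _ al01) (allowed_single _ _ al10),
      allowed_zero _⟩, ?_⟩
    change boundary ℤ (Fin 2) 0 _ = 0
    rw [map_add, bd01, bd10]
    abel
  · simp [Finsupp.single_apply]

theorem Om1 : Subsingleton (omegaHomology ℤ (Fin 2) K2 1) := by
  refine hom_subsingleton _ _ ?_
  rintro w ⟨hw, hk⟩
  have hk' : regProj ℤ (Fin 2) 0 (boundary ℤ (Fin 2) 0 w) = 0 := hk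
  rw [regProj_zero] at hk'
  have e := cycle_one w hw.1 hk'
  refine ⟨Finsupp.single ![0, 1, 0] (w ![0, 1]), ⟨allowed_single _ _ al010, ?_⟩, ?_⟩
  · change regProj ℤ (Fin 2) 1 (boundary ℤ (Fin 2) 1 _) ∈ allowedChains ℤ (Fin 2) K2 1
    rw [regbd010]
    exact Submodule.add_mem _ (allowed_single _ _ al01) (allowed_single _ _ al10)
  · rw [LinearMap.comp_apply, regbd010]
    exact e.symm

/-- Example 3.2: for the two-vertex complete digraph, `Π_n = 0` for
`n ≥ 2`, the primitive path homology is `ℤ` in degrees `0` and `1` and trivial in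
degrees `≥ 2`, while the path homology is trivial in degree `1`. -/
theorem primitive_homology_of_K2 :
    (∀ n : ℕ, 2 ≤ n → piChains ℤ (Fin 2) K2 n = ⊥) ∧
    Nonempty (piHomology ℤ (Fin 2) K2 0 ≃ₗ[ℤ] ℤ) ∧
    Nonempty (piHomology ℤ (Fin 2) K2 1 ≃ₗ[ℤ] ℤ) ∧
    (∀ n : ℕ, 2 ≤ n → Subsingleton (piHomology ℤ (Fin 2) K2 n)) ∧
    Subsingleton (omegaHomology ℤ (Fin 2) K2 1) := by
  have hbot : ∀ n : ℕ, 2 ≤ n → piChains ℤ (Fin 2) K2 n = ⊥ := by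
    intro n hn
    obtain ⟨k, rfl⟩ := Nat.exists_eq_add_of_le' hn
    exact pi_bot k
  refine ⟨hbot, H0, H1, ?_, Om1⟩
  intro n hn
  obtain ⟨k, rfl⟩ := Nat.exists_eq_add_of_le' hn
  refine hom_subsingleton _ _ ?_
  rintro w ⟨hw, _⟩
  have hw' : w ∈ piChains ℤ (Fin 2) K2 (k + 2) := hw
  rw [pi_bot, Submodule.mem_bot] at hw'
  rw [hw']
  exact Submodule.zero_mem _

end PrimitivePath

end
end

section
/- Let G be an asymmetric simple digraph. Then the chain complexes Π_*(G) and Ω_*(G) are naturally isomorphic (via the projection Λ_n(V_G) → R_n(V_G) = Λ_n/I_n), and hence the primitive path homology groups of G are naturally isomorphic to the path homology groups of G. -/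
noncomputable section

namespace PrimitivePath

theorem adj_of_allowed {V : Type} {G : SDigraph V} {n : ℕ} {p : Fin (n + 1) → V}
    (hp : IsAllowed G p) (a b : Fin (n + 1)) (h : b.val = a.val + 1) : G.Adj (p a) (p b) := by
  have hlt : a.val < n := by omega
  have h1 := hp ⟨a.val, hlt⟩
  have ha : (⟨a.val, hlt⟩ : Fin n).castSucc = a := Fin.ext rfl
  have hb : (⟨a.val, hlt⟩ : Fin n).succ = b := Fin.ext (by simp [h])
  rwa [ha, hb] at h1

theorem face_regular {V : Type} {G : SDigraph V} (hG : G.Asymmetric) {n : ℕ}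
    {p : Fin (n + 1 + 1) → V} (hp : IsAllowed G p) (m : Fin (n + 2)) :
    IsRegular (fun i : Fin (n + 1) => p (m.succAbove i)) := by
  intro i heq
  have heq' : p (m.succAbove i.castSucc) = p (m.succAbove i.succ) := heq
  have hv : (m.succAbove i.succ).val = (m.succAbove i.castSucc).val + 1 ∨
      (m.succAbove i.succ).val = (m.succAbove i.castSucc).val + 2 := by
    simp only [Fin.succAbove, Fin.lt_def]
    split_ifs <;> simp_all <;> omega
  rcases hv with h | h
  · have h1 := adj_of_allowed hp _ _ h
    rw [heq'] at h1
    exact G.loopless _ h1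
  · have hlt : (m.succAbove i.castSucc).val + 1 < n + 2 := by omega
    have h1 := adj_of_allowed hp (m.succAbove i.castSucc) ⟨_, hlt⟩ rfl
    have h2 := adj_of_allowed hp ⟨_, hlt⟩ (m.succAbove i.succ) (by simp [h])
    rw [← heq'] at h2
    exact hG _ _ h1 h2

theorem regProj_boundary (R : Type) [CommRing R] (V : Type) [DecidableEq V]
    (G : SDigraph V) (hG : G.Asymmetric) (n : ℕ) (w : Chain R V (n + 1))
    (hw : w ∈ allowedChains R V G (n + 1)) :
    regProj R V n (boundary R V n w) = boundary R V n w := by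
  have hb : boundary R V n w = w.sum fun p r => ∑ m : Fin (n + 2),
      ((-1 : R) ^ (m : ℕ)) •
        Finsupp.single (fun i : Fin (n + 1) => p (m.succAbove i)) r := by
    simp [boundary, Finsupp.sum, LinearMap.sum_apply]
  rw [hb, Finsupp.sum, map_sum]
  refine Finset.sum_congr rfl fun p hp => ?_
  rw [map_sum]
  refine Finset.sum_congr rfl fun m _ => ?_
  rw [map_smul]
  congr 1
  simp [regProj, face_regular hG (hw p hp) m]

theorem pi_eq_omega (R : Type) [CommRing R] (V : Type) [DecidableEq V]
    (G : SDigraph V) (hG : G.Asymmetric) (n : ℕ) :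
    piChains R V G n = omegaChains R V G n := by
  cases n with
  | zero => rfl
  | succ n =>
    ext w
    simp only [piChains, omegaChains, Submodule.mem_inf, Submodule.mem_comap,
      LinearMap.comp_apply]
    refine and_congr_right fun hw => ?_
    rw [regProj_boundary R V G hG n w hw]

theorem pi_allowed (R : Type) [CommRing R] (V : Type) [DecidableEq V]
    (G : SDigraph V) (n : ℕ) (w : Chain R V (n + 1)) (hw : w ∈ piChains R V G (n + 1)) :
    w ∈ allowedChains R V G (n + 1) := hw.1

theorem cycles_eq (R : Type) [CommRing R] (V : Type) [DecidableEq V]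
    (G : SDigraph V) (hG : G.Asymmetric) (n : ℕ) :
    piCycles R V G n = omegaCycles R V G n := by
  cases n with
  | zero => rfl
  | succ n =>
    ext w
    simp only [piCycles, omegaCycles, Submodule.mem_inf, LinearMap.mem_ker,
      LinearMap.comp_apply, ← pi_eq_omega R V G hG]
    refine and_congr_right fun hw => ?_
    rw [regProj_boundary R V G hG n w hw.1]

theorem boundaries_eq (R : Type) [CommRing R] (V : Type) [DecidableEq V]
    (G : SDigraph V) (hG : G.Asymmetric) (n : ℕ) :
    piBoundaries R V G n = omegaBoundaries R V G n := by
  ext w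
  simp only [piBoundaries, omegaBoundaries, Submodule.mem_map,
    LinearMap.comp_apply, ← pi_eq_omega R V G hG]
  refine exists_congr fun x => and_congr_right fun hx => ?_
  rw [regProj_boundary R V G hG n x hx.1]

/-- Theorem 3.7, Corollary 3.8: for an asymmetric digraph the chain
complexes `Π_*(G)` and `Ω_*(G)` coincide (the regular projection is the identity on
boundaries of primitive chains) and the primitive path homology is naturally isomorphic
to the path homology. -/
theorem pi_iso_omega_of_asymmetric
    (R : Type) [CommRing R] (V : Type) [DecidableEq V] [Fintype V]
    (G : SDigraph V) (hG : G.Asymmetric) :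
    (∀ n : ℕ, piChains R V G n = omegaChains R V G n) ∧
    (∀ n : ℕ, ∀ w ∈ piChains R V G (n + 1),
      regProj R V n (boundary R V n w) = boundary R V n w) ∧
    (∀ n : ℕ, Nonempty (piHomology R V G n ≃ₗ[R] omegaHomology R V G n)) := by
  refine ⟨pi_eq_omega R V G hG, fun n w hw => regProj_boundary R V G hG n w hw.1, fun n => ?_⟩
  unfold piHomology omegaHomology
  rw [cycles_eq R V G hG n, boundaries_eq R V G hG n]
  exact ⟨LinearEquiv.refl R _⟩

end PrimitivePath

end
end

section
/- Let G be a simple digraph and w ∈ A_n(G) an allowed n-path. Then w ∈ Π_n(G) if and only if ∂^m(w) ∈ A_{n-1}(G) for every m with 0 ≤ m ≤ n, where ∂^m deletes the m-th vertex of each elementary path. -/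
noncomputable section

namespace PrimitivePath

/-- If `q` fails to be allowed at position `i`, only the face `i + 1` of an allowed chain
can have a nonzero coefficient at `q`. -/
theorem faceMap_apply_eq_zero
    (R : Type) [CommRing R] (V : Type)
    (G : SDigraph V) (n : ℕ) (w : Chain R V (n + 1))
    (hw : ∀ p ∈ w.support, IsAllowed G p) (q : Fin (n + 1) → V) (i : Fin n)
    (hq : ¬ G.Adj (q i.castSucc) (q i.succ)) (m : Fin (n + 2))
    (hm : m ≠ i.succ.castSucc) : faceMap R V n m w q = 0 := by
  classical
  unfold faceMap
  rw [Finsupp.lsum_apply, Finsupp.sum, Finsupp.finset_sum_apply]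
  refine Finset.sum_eq_zero fun p hp => ?_
  rw [Finsupp.lsingle_apply, Finsupp.single_apply, if_neg]
  rintro rfl
  apply hq
  have hp' := hw p hp
  have hm' : (m : ℕ) ≠ i + 1 := fun h => hm (Fin.ext (by simpa using h))
  rcases lt_or_gt_of_ne hm' with h | h
  · have h1 : m.succAbove i.castSucc = i.succ.castSucc := by
      rw [Fin.succAbove_of_le_castSucc _ _ (by rw [Fin.le_def]; simp; omega)]
      ext; simp
    have h2 : m.succAbove i.succ = i.succ.succ := by
      rw [Fin.succAbove_of_le_castSucc _ _ (by rw [Fin.le_def]; simp; omega)]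
    simp only [h1, h2]
    exact hp' i.succ
  · have h1 : m.succAbove i.castSucc = i.castSucc.castSucc := by
      rw [Fin.succAbove_of_castSucc_lt _ _ (by rw [Fin.lt_def]; simp; omega)]
    have h2 : m.succAbove i.succ = i.castSucc.succ := by
      rw [Fin.succAbove_of_castSucc_lt _ _ (by rw [Fin.lt_def]; simp; omega)]
      ext; simp
    simp only [h1, h2]
    exact hp' i.castSucc

/-- The boundary is the alternating sum of the face maps. -/
theorem boundary_eq_sum_faceMap (R : Type) [CommRing R] (V : Type) (n : ℕ)
    (w : Chain R V (n + 1)) :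
    boundary R V n w = ∑ m : Fin (n + 2), ((-1 : R) ^ (m : ℕ)) • faceMap R V n m w := by
  have : boundary R V n = ∑ m : Fin (n + 2), ((-1 : R) ^ (m : ℕ)) • faceMap R V n m := by
    refine Finsupp.lhom_ext fun p r => ?_
    simp [boundary, faceMap, LinearMap.sum_apply]
  rw [this]
  simp [LinearMap.sum_apply]

/-- Proposition 3.9: an allowed chain `w` lies in `Π_n(G)` iff every
face `∂^m w` is an allowed chain. -/
theorem mem_pi_iff_all_faces_allowed
    (R : Type) [CommRing R] (V : Type) [DecidableEq V] [Fintype V]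
    (G : SDigraph V) (n : ℕ) (w : Chain R V (n + 1))
    (hw : w ∈ allowedChains R V G (n + 1)) :
    w ∈ piChains R V G (n + 1) ↔
      ∀ m : Fin (n + 2), faceMap R V n m w ∈ allowedChains R V G n := by
  have hw' : ∀ p ∈ w.support, IsAllowed G p := hw
  constructor
  · rintro ⟨-, hb⟩ m q hq
    have hb' : ∀ p ∈ (boundary R V n w).support, IsAllowed G p := hb
    by_contra hna
    have hna' : ¬ ∀ i : Fin n, G.Adj (q i.castSucc) (q i.succ) := hna
    obtain ⟨i, hi⟩ := not_forall.1 hna'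
    have hz := faceMap_apply_eq_zero R V G n w hw' q i hi
    have hqz : faceMap R V n m w q ≠ 0 := Finsupp.mem_support_iff.1 hq
    have hm : m = i.succ.castSucc := by
      by_contra h
      exact hqz (hz m h)
    have hb0 : boundary R V n w q = 0 := by
      by_contra h
      exact hna (hb' q (Finsupp.mem_support_iff.2 h))
    rw [boundary_eq_sum_faceMap, Finsupp.finset_sum_apply,
      Finset.sum_eq_single m] at hb0
    · rw [Finsupp.smul_apply, smul_eq_mul] at hb0
      exact hqz (((isUnit_one.neg.pow (m : ℕ)).mul_right_eq_zero).1 hb0)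
    · intro b _ hbm
      rw [Finsupp.smul_apply, hz b (hm ▸ hbm), smul_zero]
    · simp
  · intro h
    refine ⟨hw, ?_⟩
    change boundary R V n w ∈ allowedChains R V G n
    rw [boundary_eq_sum_faceMap]
    exact Submodule.sum_mem _ fun m _ => Submodule.smul_mem _ _ (h m)

end PrimitivePath

end
end

section
/- Let G be a simple digraph, w ∈ A_n(G) (n ≥ 0), and write w = Σ_{a∈V} w^{[a,·]} where w^{[a,·]} collects the elementary terms of w with tail vertex a. Then w ∈ Π_n(G) if and only if w^{[a,·]} ∈ Π_n(G) for every a. The analogous statements hold for the decomposition by head vertex and for the decomposition by (tail, head) pairs. -/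
noncomputable section

namespace PrimitivePath

section

variable {R V : Type} [CommRing R] [DecidableEq V]

theorem boundary_single_ends (G : SDigraph V) {n : ℕ} {p : Fin (n + 1 + 1) → V} {q : Fin (n + 1) → V}
    (hp : IsAllowed G p) (hq : ¬ IsAllowed G q) (r : R)
    (h : boundary R V n (Finsupp.single p r) q ≠ 0) :
    p 0 = q 0 ∧ p (Fin.last (n + 1)) = q (Fin.last n) := by
  have h1 : ∃ m : Fin (n + 2), (fun i : Fin (n + 1) => p (m.succAbove i)) = q := by
    by_contra hcon
    push Not at hcon
    apply h
    simp only [boundary, Finsupp.lsum_single, LinearMap.sum_apply, LinearMap.smul_apply,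
      Finsupp.lsingle_apply, Finsupp.finsetSum_apply, Finsupp.smul_apply]
    refine Finset.sum_eq_zero fun m _ => ?_
    rw [Finsupp.single_eq_of_ne (hcon m).symm, smul_zero]
  obtain ⟨m, rfl⟩ := h1
  have hm0 : m ≠ 0 := by
    rintro rfl
    apply hq
    intro i
    simpa using hp i.succ
  have hml : m ≠ Fin.last (n + 1) := by
    rintro rfl
    apply hq
    intro i
    simpa using hp i.castSucc
  constructor
  · exact (congrArg p (Fin.succAbove_ne_zero_zero hm0)).symm
  · exact (congrArg p (Fin.succAbove_ne_last_last hml)).symm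

/-- A linear map is the component map of a condition `Q` on (tail, head). -/
def IsComp (n : ℕ) (Q : V → V → Prop) (T : Chain R V n →ₗ[R] Chain R V n) : Prop :=
  (∀ p r, Q (p 0) (p (Fin.last n)) → T (Finsupp.single p r) = Finsupp.single p r) ∧
  (∀ p r, ¬ Q (p 0) (p (Fin.last n)) → T (Finsupp.single p r) = 0)

theorem map_eq_sum_single {n : ℕ} {M : Type} [AddCommGroup M] [Module R M]
    (F : Chain R V n →ₗ[R] M) (w : Chain R V n) :
    F w = ∑ p ∈ w.support, F (Finsupp.single p (w p)) := by
  conv_lhs => rw [← Finsupp.sum_single w]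
  rw [Finsupp.sum, map_sum]

theorem comp_allowed (G : SDigraph V) {n : ℕ} {Q : V → V → Prop}
    {T : Chain R V n →ₗ[R] Chain R V n} (hT : IsComp n Q T) {w : Chain R V n}
    (hw : w ∈ allowedChains R V G n) : T w ∈ allowedChains R V G n := by
  rw [map_eq_sum_single T w]
  refine Submodule.sum_mem _ fun p hp => ?_
  by_cases hQ : Q (p 0) (p (Fin.last n))
  · rw [hT.1 _ _ hQ]
    intro p' hp'
    have := Finset.mem_singleton.1 (Finsupp.support_single_subset hp')
    rw [this]
    exact hw p hp
  · rw [hT.2 _ _ hQ]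
    exact Submodule.zero_mem _

theorem comp_pi (G : SDigraph V) {n : ℕ} {Q : V → V → Prop}
    {T : Chain R V n →ₗ[R] Chain R V n} (hT : IsComp n Q T) {w : Chain R V n}
    (hw : w ∈ piChains R V G n) : T w ∈ piChains R V G n := by
  cases n with
  | zero => exact comp_allowed G hT hw
  | succ n =>
    refine ⟨comp_allowed G hT hw.1, ?_⟩
    intro q hq
    by_contra hqa
    rw [Finsupp.mem_support_iff] at hq
    apply hq
    have hw2 : boundary R V n w q = 0 := by
      by_contra hne
      exact hqa (hw.2 q (Finsupp.mem_support_iff.2 hne))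
    have e1 := map_eq_sum_single ((Finsupp.lapply q).comp (boundary R V n)) w
    have e2 := map_eq_sum_single ((Finsupp.lapply q).comp ((boundary R V n).comp T)) w
    simp only [LinearMap.comp_apply, Finsupp.lapply_apply] at e1 e2
    rw [e2]
    by_cases hQ : Q (q 0) (q (Fin.last n))
    · rw [← hw2, e1]
      refine Finset.sum_congr rfl fun p hp => ?_
      by_cases hQp : Q (p 0) (p (Fin.last (n + 1)))
      · rw [hT.1 _ _ hQp]
      · rw [hT.2 _ _ hQp, map_zero, Finsupp.zero_apply]
        by_contra hne
        obtain ⟨h0, h1⟩ := boundary_single_ends G (hw.1 p hp) hqa (w p) (Ne.symm hne)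
        rw [h0, h1] at hQp
        exact hQp hQ
    · refine Finset.sum_eq_zero fun p hp => ?_
      by_cases hQp : Q (p 0) (p (Fin.last (n + 1)))
      · rw [hT.1 _ _ hQp]
        by_contra hne
        obtain ⟨h0, h1⟩ := boundary_single_ends G (hw.1 p hp) hqa (w p) hne
        rw [h0, h1] at hQp
        exact hQ hQp
      · rw [hT.2 _ _ hQp, map_zero, Finsupp.zero_apply]

theorem isComp_tail (a : V) (n : ℕ) :
    IsComp n (fun x _ => x = a) (tailComp R V a n) := by
  constructor <;> intro p r h <;> (try simp only at h) <;> simp [tailComp, h]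

theorem isComp_head (b : V) (n : ℕ) :
    IsComp n (fun _ y => y = b) (headComp R V b n) := by
  constructor <;> intro p r h <;> (try simp only at h) <;> simp [headComp, h]

theorem isComp_cluster (a b : V) (n : ℕ) :
    IsComp n (fun x y => x = a ∧ y = b) (clusterComp R V a b n) := by
  constructor <;> intro p r h <;> (try simp only at h) <;>
    simp only [clusterComp, Finsupp.lsum_single, h, if_true, if_false, and_self,
      Finsupp.lsingle_apply, LinearMap.zero_apply]

theorem sum_comp {ι : Type} [Fintype ι] [DecidableEq ι] {n : ℕ} {Q : ι → V → V → Prop}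
    {T : ι → Chain R V n →ₗ[R] Chain R V n} (hT : ∀ i, IsComp n (Q i) (T i))
    (f : V → V → ι) (hf : ∀ i x y, Q i x y ↔ f x y = i) (w : Chain R V n) :
    ∑ i, T i w = w := by
  have : ∑ i, T i = LinearMap.id := by
    refine Finsupp.lhom_ext fun p r => ?_
    rw [LinearMap.sum_apply, LinearMap.id_apply,
      Finset.sum_eq_single (f (p 0) (p (Fin.last n)))]
    · exact (hT _).1 _ _ ((hf _ _ _).2 rfl)
    · intro i _ hi
      exact (hT _).2 _ _ fun h => hi ((hf _ _ _).1 h).symm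
    · intro h
      exact absurd (Finset.mem_univ _) h
  rw [← LinearMap.sum_apply, this, LinearMap.id_apply]

end

/-- Theorem 4.3: an allowed chain `w` lies in `Π_n(G)` iff all its
tail components `w^{[a,·]}` do, iff all its head components `w^{[·,b]}` do, iff all its
cluster components `w^{[a,b]}` do. -/
theorem pi_component_decompositions
    (R : Type) [CommRing R] (V : Type) [DecidableEq V] [Fintype V]
    (G : SDigraph V) (n : ℕ) (w : Chain R V n)
    (hw : w ∈ allowedChains R V G n) :
    (w ∈ piChains R V G n ↔ ∀ a : V, tailComp R V a n w ∈ piChains R V G n) ∧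
    (w ∈ piChains R V G n ↔ ∀ b : V, headComp R V b n w ∈ piChains R V G n) ∧
    (w ∈ piChains R V G n ↔
      ∀ a b : V, clusterComp R V a b n w ∈ piChains R V G n) := by
  refine ⟨⟨fun h a => comp_pi G (isComp_tail a n) h, fun h => ?_⟩,
    ⟨fun h b => comp_pi G (isComp_head b n) h, fun h => ?_⟩,
    ⟨fun h a b => comp_pi G (isComp_cluster a b n) h, fun h => ?_⟩⟩
  · rw [← sum_comp (fun a : V => isComp_tail (R := R) a n) (fun x _ => x) (by simp) w]
    exact Submodule.sum_mem _ fun a _ => h a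
  · rw [← sum_comp (fun b : V => isComp_head (R := R) b n) (fun _ y => y) (by simp) w]
    exact Submodule.sum_mem _ fun b _ => h b
  · rw [← sum_comp (fun c : V × V => isComp_cluster (R := R) c.1 c.2 n) (fun x y => (x, y))
      (by simp [Prod.ext_iff]) w]
    exact Submodule.sum_mem _ fun c _ => h c.1 c.2

end PrimitivePath

end
end
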